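/- arXiv:2306.10389 — 2 statements merged into one kernel-verified Lean document; each statement's English description precedes it below -/
import Mathlib

section
/- Let A and B be locally small categories such that A has all small colimits, and let f : A ⥤ B be a functor. Then f has a right adjoint if and only if f preserves all small colimits and f satisfies the solution set condition. (Freyd's adjoint functor theorem.) -/
open CategoryTheory CategoryTheory.Limits

universe v u₁ u₂

/-- A functor `f : A ⥤ B` satisfies the solution set condition if for every `b : B` there is a
small family of objects `a i` of `A` and morphisms `g i : f.obj (a i) ⟶ b` through which every
morphism `f.obj x ⟶ b` factors. -/
def SolutionSetCondition {A : Type u₁} {B : Type u₂} [Category.{v} A] [Category.{v} B]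
    (f : A ⥤ B) : Prop :=
  ∀ b : B, ∃ (ι : Type v) (a : ι → A) (g : ∀ i : ι, f.obj (a i) ⟶ b),
    ∀ (x : A) (h : f.obj x ⟶ b), ∃ (i : ι) (t : x ⟶ a i), f.map t ≫ g i = h

/-- The solution set condition for `f` gives the dual solution set condition for `f.op`. -/
theorem SolutionSetCondition.op {A : Type u₁} {B : Type u₂} [Category.{v} A] [Category.{v} B]
    {f : A ⥤ B} (hf : _root_.SolutionSetCondition f) :
    CategoryTheory.SolutionSetCondition.{v} f.op := by
  intro b
  obtain ⟨ι, a, g, hg⟩ := hf b.unop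
  refine ⟨ι, fun i => .op (a i), fun i => (g i).op, fun x h => ?_⟩
  obtain ⟨i, t, ht⟩ := hg x.unop h.unop
  exact ⟨i, t.op, Quiver.Hom.unop_inj ht⟩

theorem SolutionSetCondition.of_isLeftAdjoint {A : Type u₁} {B : Type u₂}
    [Category.{v} A] [Category.{v} B] (f : A ⥤ B) [f.IsLeftAdjoint] :
    _root_.SolutionSetCondition f := by
  intro b
  let adj := Adjunction.ofIsLeftAdjoint f
  exact ⟨PUnit, fun _ => f.rightAdjoint.obj b, fun _ => adj.counit.app b,
    fun x h => ⟨.unit, adj.homEquiv x b h, by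
      rw [← adj.homEquiv_counit, Equiv.symm_apply_apply]⟩⟩

/-- Freyd's adjoint functor theorem: a functor `f` from a locally small category with all small
colimits has a right adjoint iff it preserves all small colimits and satisfies the solution set
condition. -/
theorem freyd_adjoint_functor_theorem {A : Type u₁} {B : Type u₂}
    [Category.{v} A] [Category.{v} B] [HasColimitsOfSize.{v, v} A] (f : A ⥤ B) :
    f.IsLeftAdjoint ↔ PreservesColimitsOfSize.{v, v} f ∧ _root_.SolutionSetCondition f := by
  refine ⟨fun _ => ⟨(Adjunction.ofIsLeftAdjoint f).leftAdjoint_preservesColimits,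
    .of_isLeftAdjoint f⟩, fun ⟨_, hf⟩ => ?_⟩
  have : PreservesLimitsOfSize.{v, v} f.op := preservesLimitsOfSize_op f
  have : f.op.IsRightAdjoint :=
    isRightAdjoint_of_preservesLimits_of_solutionSetCondition f.op hf.op
  exact (Adjunction.ofIsRightAdjoint f.op).unop.isLeftAdjoint
end

section
/- Let A be a locally finitely presentable category: A is locally small, has all small colimits, and there exists a small set S of objects of A such that (i) every object s ∈ S is finitely presentable, i.e. the hom-functor Hom_A(s, −) : A ⥤ Type v preserves colimits of small filtered diagrams, and (ii) every object of A is the colimit of a small filtered diagram all of whose objects belong to S. Let B be a locally small category having all small colimits. Then a functor f : A ⥤ B has a right adjoint if and only if f preserves all small colimits. -/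
open CategoryTheory CategoryTheory.Limits Opposite

universe v u₁ u₂

/-- A locally small category `A` with all small colimits is locally finitely presentable if
there is a small set `S` of objects such that every `s ∈ S` is finitely presentable (its
hom-functor `Hom(s, −)` preserves small filtered colimits) and every object of `A` is a small
filtered colimit of objects of `S`. -/
def IsLocallyFinitelyPresentable (A : Type u₁) [Category.{v} A]
    [HasColimitsOfSize.{v, v} A] : Prop :=
  ∃ S : Set A, Small.{v} S ∧
    (∀ s ∈ S, ∀ (J : Type v) [SmallCategory J], IsFiltered J →
      PreservesColimitsOfShape J (coyoneda.obj (op s))) ∧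
    (∀ a : A, ∃ (J : Type v) (_ : SmallCategory J) (_ : IsFiltered J) (G : J ⥤ A),
      (∀ j : J, G.obj j ∈ S) ∧ Nonempty (colimit G ≅ a))

namespace CategoryTheory

/-- If every object of a cocomplete category `A` is a small colimit of objects in a small set `S`,
then the opposite of a cocontinuous functor on `A` satisfies the solution set condition. The
solution set for `b` is the single object `colim_{(s, f s ⟶ b)} s`, with `s` ranging over `S`. -/
lemma solutionSetCondition_op_of_preservesColimits
    {A : Type u₁} {B : Type u₂} [Category.{v} A] [Category.{v} B]
    [HasColimitsOfSize.{v, v} A] (S : Set A) [Small.{v} S]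
    (hS : ∀ a : A, ∃ (J : Type v) (_ : SmallCategory J) (G : J ⥤ A),
      (∀ j : J, G.obj j ∈ S) ∧ Nonempty (colimit G ≅ a))
    (f : A ⥤ B) [PreservesColimitsOfSize.{v, v} f] :
    SolutionSetCondition.{v} f.op := by
  intro b
  let P : ObjectProperty A := fun a => a ∈ S
  have : EssentiallySmall.{v} P.FullSubcategory := essentiallySmall_fullSubcategory_mem (C := A) S
  let K := CostructuredArrow (P.ι ⋙ f) b.unop
  have : EssentiallySmall.{v} K := inferInstance
  have : HasColimitsOfShape K A := hasColimitsOfShape_of_equivalence (equivSmallModel.{v} K).symm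
  have : PreservesColimitsOfShape K f :=
    preservesColimitsOfShape_of_equiv (equivSmallModel.{v} K).symm f
  let D : K ⥤ A := CostructuredArrow.proj (P.ι ⋙ f) b.unop ⋙ P.ι
  let c : Cocone (D ⋙ f) :=
    { pt := b.unop
      ι := { app := fun k => k.hom
             naturality := fun _ _ g => (CostructuredArrow.w g).trans (Category.comp_id _).symm } }
  let hD := isColimitOfPreserves f (colimit.isColimit D)
  refine ⟨PUnit, fun _ => op (colimit D), fun _ => (hD.desc c).op, fun x h => ?_⟩
  obtain ⟨J, _, G, hG, ⟨e⟩⟩ := hS x.unop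
  let k (j : J) : K :=
    CostructuredArrow.mk (S := P.ι ⋙ f) (Y := ⟨G.obj j, hG j⟩)
      (f.map (colimit.ι G j ≫ e.hom) ≫ h.unop)
  let k' {i j : J} (g : i ⟶ j) : k i ⟶ k j :=
    CostructuredArrow.homMk (ObjectProperty.homMk (G.map g)) (by
      change f.map (G.map g) ≫ f.map (colimit.ι G j ≫ e.hom) ≫ h.unop =
        f.map (colimit.ι G i ≫ e.hom) ≫ h.unop
      rw [← f.map_comp_assoc, colimit.w_assoc])
  let d : Cocone G :=
    { pt := colimit D
      ι := { app := fun j => colimit.ι D (k j)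
             naturality := fun _ _ g =>
               (colimit.w D (k' g)).trans (Category.comp_id _).symm } }
  refine ⟨PUnit.unit, (e.inv ≫ colimit.desc G d).op, Quiver.Hom.unop_inj ?_⟩
  change f.map (e.inv ≫ colimit.desc G d) ≫ hD.desc c = h.unop
  rw [f.map_comp, Category.assoc, ← Functor.mapIso_inv, Iso.inv_comp_eq]
  refine (isColimitOfPreserves f (colimit.isColimit G)).hom_ext fun j => ?_
  have hj : f.map (colimit.ι D (k j)) ≫ hD.desc c = (k j).hom := hD.fac c (k j)
  change f.map (colimit.ι G j) ≫ f.map (colimit.desc G d) ≫ hD.desc c =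
    f.map (colimit.ι G j) ≫ f.map e.hom ≫ h.unop
  rw [← f.map_comp_assoc, colimit.ι_desc, ← f.map_comp_assoc]
  exact hj

/-- A functor whose opposite is a right adjoint is a left adjoint. -/
lemma Functor.isLeftAdjoint_of_isRightAdjoint_op
    {A : Type u₁} {B : Type u₂} [Category.{v} A] [Category.{v} B]
    (f : A ⥤ B) [f.op.IsRightAdjoint] : f.IsLeftAdjoint :=
  ⟨f.op.leftAdjoint.unop, ⟨(Adjunction.ofIsRightAdjoint f.op).unop⟩⟩

end CategoryTheory

/-- A functor from a locally finitely presentable category to a locally small category with all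
small colimits has a right adjoint iff it preserves all small colimits. -/
theorem isLeftAdjoint_iff_preservesColimits_of_locallyFinitelyPresentable
    {A : Type u₁} {B : Type u₂} [Category.{v} A] [Category.{v} B]
    [HasColimitsOfSize.{v, v} A] [HasColimitsOfSize.{v, v} B]
    (hA : _root_.IsLocallyFinitelyPresentable A) (f : A ⥤ B) :
    f.IsLeftAdjoint ↔ PreservesColimitsOfSize.{v, v} f := by
  constructor
  · intro _
    exact (Adjunction.ofIsLeftAdjoint f).leftAdjoint_preservesColimits
  · intro _
    obtain ⟨S, _, -, hS⟩ := hA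
    have := preservesLimitsOfSize_op f
    have := isRightAdjoint_of_preservesLimits_of_solutionSetCondition f.op
      (solutionSetCondition_op_of_preservesColimits S
        (fun a => let ⟨J, hJ, _, h⟩ := hS a; ⟨J, hJ, h⟩) f)
    exact f.isLeftAdjoint_of_isRightAdjoint_op
end
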